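/- Let n, ℓ ∈ ℕ with n ≥ 2 and ℓ ≥ 1, and let R' be a path-stable configuration reachable from R(ℓ) by path-firing moves. Then there is at most one index i with R'_i = R'_{i+1} and 0 < R'_i < n; that is, among consecutive pairs of entries strictly between 0 and n, at most one repeated weight occurs. -/

import Mathlib

/-- A path-firing move on path configurations of length `k` (positions `1,…,k`):
fire from position `i` into an adjacent position `j`. -/
def PFireFrom (k i : ℕ) (R R' : ℕ → ℤ) : Prop :=
  ∃ j : ℕ, 1 ≤ i ∧ i ≤ k ∧ 1 ≤ j ∧ j ≤ k ∧ (i = j + 1 ∨ j = i + 1) ∧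
    R j + 2 ≤ R i ∧
    R' = Function.update (Function.update R i (R i - 1)) j (R j + 1)

/-- A path-firing move on path configurations of length `k`. -/
def PFire (k : ℕ) (R R' : ℕ → ℤ) : Prop := ∃ i : ℕ, PFireFrom k i R R'

/-- `R'` is reachable from `R` by path-firing moves along a path of length `k`. -/
def PReaches (k : ℕ) (R R' : ℕ → ℤ) : Prop := Relation.ReflTransGen (PFire k) R R'

/-- A path configuration is path-stable if no path-firing move applies. -/
def PStable (k : ℕ) (R : ℕ → ℤ) : Prop := ∀ R', ¬ PFire k R R'

/-- The length of the path `𝒫(ℓ)`: `ℓ + (n − ⌈n/2⌉)`. -/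
def pathLen (n ℓ : ℕ) : ℕ := ℓ + (n - (n + 1) / 2)

/-- The initial path configuration `R(ℓ)`: the first `ℓ` entries equal `n`,
the remaining `n − ⌈n/2⌉` entries equal `0`. -/
def Rinit (n ℓ : ℕ) : ℕ → ℤ :=
  fun i => if 1 ≤ i ∧ i ≤ ℓ then (n : ℤ) else 0

/-- A weakly decreasing configuration with entries in `[0, n]` such that any two repeated weights
strictly between `0` and `n` are separated by a descent of size at least two. -/
structure SeparatedRepeats (k : ℕ) (n : ℤ) (R : ℕ → ℤ) : Prop where
  nonneg : ∀ i, 1 ≤ i → i ≤ k → 0 ≤ R i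
  le : ∀ i, 1 ≤ i → i ≤ k → R i ≤ n
  anti : ∀ i j, 1 ≤ i → i ≤ j → j ≤ k → R j ≤ R i
  exists_descent : ∀ i j, 1 ≤ i → i < j → j + 1 ≤ k → R i = R (i + 1) → R j = R (j + 1) →
    R i < n → 0 < R j → ∃ m, i < m ∧ m < j ∧ R (m + 1) + 2 ≤ R m

theorem SeparatedRepeats.of_rinit (n ℓ k : ℕ) : SeparatedRepeats k n (Rinit n ℓ) where
  nonneg i _ _ := by unfold Rinit; split_ifs <;> omega
  le i _ _ := by unfold Rinit; split_ifs <;> omega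
  anti i j _ _ _ := by unfold Rinit; split_ifs <;> omega
  exists_descent i j _ _ _ _ _ hi hj := by
    unfold Rinit at hi hj; split_ifs at hi hj <;> omega

theorem SeparatedRepeats.update {k : ℕ} {n : ℤ} {R R' : ℕ → ℤ} (h : SeparatedRepeats k n R)
    {s : ℕ} (hs : 1 ≤ s) (hsk : s + 1 ≤ k) (hfire : R (s + 1) + 2 ≤ R s)
    (hself : R' s = R s - 1) (hnext : R' (s + 1) = R (s + 1) + 1)
    (hR' : ∀ t, t ≠ s → t ≠ s + 1 → R' t = R t) : SeparatedRepeats k n R' where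
  nonneg i hi hik := by
    have := h.nonneg i hi hik
    have := h.nonneg (s + 1) (by omega) hsk
    grind
  le i hi hik := by
    have := h.le i hi hik
    have := h.le s hs (by omega)
    grind
  anti i j hi hij hjk := by
    have := h.anti i j hi hij hjk
    have : s + 1 ≤ j → R j ≤ R (s + 1) := fun hj => h.anti (s + 1) j (by omega) hj hjk
    have : i ≤ s → R s ≤ R i := fun his => h.anti i s hi his (by omega)
    grind
  exists_descent i j hi hij hjk hRi hRj hin hj0 := by
    have hleft : 1 ≤ s - 1 → R s ≤ R (s - 1) := fun _ =>
      h.anti (s - 1) s (by omega) (by omega) (by omega)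
    have hright : s + 2 ≤ k → R (s + 2) ≤ R (s + 1) := fun _ =>
      h.anti (s + 1) (s + 2) (by omega) (by omega) (by omega)
    have hi1 : i + 1 ≠ s := by grind
    have hi2 : i ≠ s + 1 := by grind
    have hj1 : j + 1 ≠ s := by grind
    have hj2 : j ≠ s + 1 := by grind
    have hs0 := h.nonneg (s + 1) (by omega) hsk
    have hsn := h.le s hs (by omega)
    -- a descent strictly between `i` and `s`, when `i` lies to the left of `s`
    have descent_left : i < s → R (s - 1) = R s → ∃ m, i < m ∧ m < s - 1 ∧ R (m + 1) + 2 ≤ R m := by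
      intro his hd
      have := h.anti i (s - 1) hi (by omega) (by omega)
      refine h.exists_descent i (s - 1) hi (by omega) (by omega) ?_ ?_ ?_ ?_ <;> grind
    -- a descent strictly between `s` and `j`, when `j` lies to the right of `s`
    have descent_right : s < j → R (s + 1) = R (s + 2) →
        ∃ m, s + 1 < m ∧ m < j ∧ R (m + 1) + 2 ≤ R m := by
      intro hsj hd
      have := h.anti (s + 1) j (by omega) (by omega) (by omega)
      refine h.exists_descent (s + 1) j (by omega) (by omega) hjk ?_ ?_ ?_ ?_ <;> grind
    by_cases his : i < s ∧ s ≤ j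
    · by_cases hd : R (s - 1) = R s
      · obtain ⟨m, h1, h2, h3⟩ := descent_left his.1 hd
        exact ⟨m, h1, by omega, by grind⟩
      · clear descent_left descent_right; exact ⟨s - 1, by omega, by omega, by grind⟩
    · by_cases his : i = s
      · by_cases hd : R (s + 1) = R (s + 2)
        · obtain ⟨m, h1, h2, h3⟩ := descent_right (by omega) hd
          exact ⟨m, by omega, h2, by grind⟩
        · clear descent_left descent_right; exact ⟨s + 1, by omega, by omega, by grind⟩
      · obtain ⟨m, h1, h2, h3⟩ := h.exists_descent i j hi hij hjk (by grind) (by grind)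
          (by grind) (by grind)
        exact ⟨m, h1, h2, by grind⟩

theorem SeparatedRepeats.fire {k : ℕ} {n : ℤ} {R R' : ℕ → ℤ} (h : SeparatedRepeats k n R)
    (hfire : PFire k R R') : SeparatedRepeats k n R' := by
  obtain ⟨i, j, hi, hik, hj, hjk, hij | rfl, hR, rfl⟩ := hfire
  · have := h.anti j i hj (by omega) hik
    omega
  · exact h.update hi hjk hR (by simp) (by simp) fun t h1 h2 => by simp [h1, h2]

theorem SeparatedRepeats.reaches {k : ℕ} {n : ℤ} {R R' : ℕ → ℤ} (h : SeparatedRepeats k n R)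
    (hreach : PReaches k R R') : SeparatedRepeats k n R' := by
  induction hreach with
  | refl => exact h
  | tail _ hfire ih => exact ih.fire hfire

theorem SeparatedRepeats.not_lt_of_stable {k : ℕ} {n : ℤ} {R : ℕ → ℤ}
    (h : SeparatedRepeats k n R) (hstable : PStable k R) {i j : ℕ} (hi : 1 ≤ i) (hjk : j + 1 ≤ k)
    (hRi : R i = R (i + 1)) (hRj : R j = R (j + 1)) (hin : R i < n) (hj0 : 0 < R j) :
    ¬ i < j := by
  intro hij
  obtain ⟨m, him, hmj, hm⟩ := h.exists_descent i j hi hij hjk hRi hRj hin hj0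
  exact hstable _ ⟨m, m + 1, by omega, by omega, by omega, by omega, Or.inr rfl, hm, rfl⟩

theorem at_most_one_repeated_weight
    (n ℓ : ℕ) (hn : 2 ≤ n) (hℓ : 1 ≤ ℓ)
    (R' : ℕ → ℤ) (hreach : PReaches (pathLen n ℓ) (Rinit n ℓ) R')
    (hstable : PStable (pathLen n ℓ) R') :
    ∀ i j : ℕ,
      (1 ≤ i ∧ i + 1 ≤ pathLen n ℓ ∧ R' i = R' (i + 1) ∧ 0 < R' i ∧ R' i < n) →
      (1 ≤ j ∧ j + 1 ≤ pathLen n ℓ ∧ R' j = R' (j + 1) ∧ 0 < R' j ∧ R' j < n) →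
      i = j := by
  rintro i j ⟨hi, hik, hRi, hi0, hin⟩ ⟨hj, hjk, hRj, hj0, hjn⟩
  have h := (SeparatedRepeats.of_rinit n ℓ (pathLen n ℓ)).reaches hreach
  have := h.not_lt_of_stable hstable hi hjk hRi hRj hin hj0
  have := h.not_lt_of_stable hstable hj hik hRj hRi hjn hi0
  omega
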